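/- For every real number a > 0, the orbit of the point (a,0,0) under the group G_{H3} is exactly the set {±(a,0,0), ±(−a,a,0), ±(0,−a,aτ), ±(0,aτ,−aτ), ±(aτ,−aτ,a), ±(−aτ,0,a)}, and these twelve points are pairwise distinct. -/

import Mathlib

noncomputable section

/-- The golden ratio `τ = (1+√5)/2`, satisfying `τ² = τ + 1`. -/
def τ : ℝ := (1 + Real.sqrt 5) / 2

/-- Simple reflection number 1 in the ω-basis. -/
def f1 : (ℝ × ℝ × ℝ) →ₗ[ℝ] (ℝ × ℝ × ℝ) where
  toFun p := (-p.1, p.1 + p.2.1, p.2.2)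
  map_add' p q := by refine Prod.ext ?_ (Prod.ext ?_ ?_) <;> simp <;> ring
  map_smul' c p := by refine Prod.ext ?_ (Prod.ext ?_ ?_) <;> simp <;> ring

def r1 : (ℝ × ℝ × ℝ) ≃ₗ[ℝ] (ℝ × ℝ × ℝ) :=
  LinearEquiv.ofLinear f1 f1
    (by apply LinearMap.ext; intro p
        refine Prod.ext ?_ (Prod.ext ?_ ?_) <;> simp [f1] <;> ring)
    (by apply LinearMap.ext; intro p
        refine Prod.ext ?_ (Prod.ext ?_ ?_) <;> simp [f1] <;> ring)

/-- Simple reflection number 2 in the ω-basis. -/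
def f2 : (ℝ × ℝ × ℝ) →ₗ[ℝ] (ℝ × ℝ × ℝ) where
  toFun p := (p.1 + p.2.1, -p.2.1, τ * p.2.1 + p.2.2)
  map_add' p q := by refine Prod.ext ?_ (Prod.ext ?_ ?_) <;> simp <;> ring
  map_smul' c p := by refine Prod.ext ?_ (Prod.ext ?_ ?_) <;> simp <;> ring

def r2 : (ℝ × ℝ × ℝ) ≃ₗ[ℝ] (ℝ × ℝ × ℝ) :=
  LinearEquiv.ofLinear f2 f2
    (by apply LinearMap.ext; intro p
        refine Prod.ext ?_ (Prod.ext ?_ ?_) <;> simp [f2] <;> ring)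
    (by apply LinearMap.ext; intro p
        refine Prod.ext ?_ (Prod.ext ?_ ?_) <;> simp [f2] <;> ring)

/-- Simple reflection number 3 in the ω-basis. -/
def f3 : (ℝ × ℝ × ℝ) →ₗ[ℝ] (ℝ × ℝ × ℝ) where
  toFun p := (p.1, p.2.1 + τ * p.2.2, -p.2.2)
  map_add' p q := by refine Prod.ext ?_ (Prod.ext ?_ ?_) <;> simp <;> ring
  map_smul' c p := by refine Prod.ext ?_ (Prod.ext ?_ ?_) <;> simp <;> ring

def r3 : (ℝ × ℝ × ℝ) ≃ₗ[ℝ] (ℝ × ℝ × ℝ) :=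
  LinearEquiv.ofLinear f3 f3
    (by apply LinearMap.ext; intro p
        refine Prod.ext ?_ (Prod.ext ?_ ?_) <;> simp [f3] <;> ring)
    (by apply LinearMap.ext; intro p
        refine Prod.ext ?_ (Prod.ext ?_ ?_) <;> simp [f3] <;> ring)

/-- The Coxeter group, as the group of linear automorphisms of `ℝ³`
generated by the three simple reflections. -/
def GH3 : Subgroup ((ℝ × ℝ × ℝ) ≃ₗ[ℝ] (ℝ × ℝ × ℝ)) := Subgroup.closure {r1, r2, r3}

lemma τ_sq : τ * τ = τ + 1 := by
  have h : √5 * √5 = (5 : ℝ) := Real.mul_self_sqrt (by norm_num)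
  unfold τ
  linarith

lemma τ_pos : 0 < τ := by
  unfold τ
  positivity

lemma r1_apply (x y z : ℝ) : r1 (x, y, z) = (-x, x + y, z) := rfl

lemma r2_apply (x y z : ℝ) : r2 (x, y, z) = (x + y, -y, τ * y + z) := rfl

lemma r3_apply (x y z : ℝ) : r3 (x, y, z) = (x, y + τ * z, -z) := rfl

lemma orbit_GH3_subset {s : Set (ℝ × ℝ × ℝ)} (hs : s.Finite) {p : ℝ × ℝ × ℝ} (hp : p ∈ s)
    (h1 : ∀ q ∈ s, r1 q ∈ s) (h2 : ∀ q ∈ s, r2 q ∈ s) (h3 : ∀ q ∈ s, r3 q ∈ s) :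
    MulAction.orbit GH3 p ⊆ s := by
  open scoped Pointwise in
  have hle : GH3 ≤ MulAction.stabilizer _ s := by
    refine (Subgroup.closure_le _).2 ?_
    rintro g (rfl | rfl | rfl) <;>
      refine (MulAction.mem_stabilizer_set_iff_smul_set_subset hs).2 ?_ <;>
      rintro _ ⟨q, hq, rfl⟩
    exacts [h1 q hq, h2 q hq, h3 q hq]
  rintro _ ⟨⟨g, hg⟩, rfl⟩
  exact (MulAction.mem_stabilizer_set.1 (hle hg) p).2 hp

lemma apply_mem_orbit_GH3 {g : (ℝ × ℝ × ℝ) ≃ₗ[ℝ] (ℝ × ℝ × ℝ)} (hg : g ∈ GH3)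
    {p q : ℝ × ℝ × ℝ} (hq : q ∈ MulAction.orbit GH3 p) : g q ∈ MulAction.orbit GH3 p :=
  MulAction.mem_orbit_of_mem_orbit (⟨g, hg⟩ : GH3) hq

theorem orbit_H3_of_a00 (a : ℝ) (ha : 0 < a) :
    MulAction.orbit GH3 ((a, 0, 0) : ℝ × ℝ × ℝ) =
      ({(a, 0, 0), (-a, 0, 0), (-a, a, 0), (a, -a, 0),
        (0, -a, a * τ), (0, a, -(a * τ)),
        (0, a * τ, -(a * τ)), (0, -(a * τ), a * τ),
        (a * τ, -(a * τ), a), (-(a * τ), a * τ, -a),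
        (-(a * τ), 0, a), (a * τ, 0, -a)} : Set (ℝ × ℝ × ℝ)) ∧
    ([(a, 0, 0), (-a, 0, 0), (-a, a, 0), (a, -a, 0),
      (0, -a, a * τ), (0, a, -(a * τ)),
      (0, a * τ, -(a * τ)), (0, -(a * τ), a * τ),
      (a * τ, -(a * τ), a), (-(a * τ), a * τ, -a),
      (-(a * τ), 0, a), (a * τ, 0, -a)] : List (ℝ × ℝ × ℝ)).Nodup := by
  have hτ := τ_sq
  have haτ : 0 < a * τ := mul_pos ha τ_pos
  have hmul : τ * (a * τ) = a * τ + a := by linear_combination a * hτ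
  refine ⟨Set.Subset.antisymm (orbit_GH3_subset (Set.toFinite _) (by simp) ?_ ?_ ?_) ?_, ?_⟩
  · rintro q (rfl | rfl | rfl | rfl | rfl | rfl | rfl | rfl | rfl | rfl | rfl | rfl) <;>
      simp [r1_apply]
  · rintro q (rfl | rfl | rfl | rfl | rfl | rfl | rfl | rfl | rfl | rfl | rfl | rfl) <;>
      simp [r2_apply, hmul, mul_comm τ a]
  · rintro q (rfl | rfl | rfl | rfl | rfl | rfl | rfl | rfl | rfl | rfl | rfl | rfl) <;>
      simp [r3_apply, hmul, mul_comm τ a]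
  · set O := MulAction.orbit GH3 ((a, 0, 0) : ℝ × ℝ × ℝ)
    have R1 {x y z : ℝ} (h : (x, y, z) ∈ O) : (-x, x + y, z) ∈ O :=
      apply_mem_orbit_GH3 (g := r1) (Subgroup.subset_closure (by simp)) h
    have R2 {x y z : ℝ} (h : (x, y, z) ∈ O) : (x + y, -y, τ * y + z) ∈ O :=
      apply_mem_orbit_GH3 (g := r2) (Subgroup.subset_closure (by simp)) h
    have R3 {x y z : ℝ} (h : (x, y, z) ∈ O) : (x, y + τ * z, -z) ∈ O :=
      apply_mem_orbit_GH3 (g := r3) (Subgroup.subset_closure (by simp)) h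
    have p₁ : (a, 0, 0) ∈ O := MulAction.mem_orbit_self _
    have p₂ : (-a, a, 0) ∈ O := by simpa using R1 p₁
    have p₃ : (0, -a, a * τ) ∈ O := by simpa [mul_comm τ a] using R2 p₂
    have p₄ : (0, a * τ, -(a * τ)) ∈ O := by simpa [hmul] using R3 p₃
    have p₅ : (a * τ, -(a * τ), a) ∈ O := by simpa [hmul] using R2 p₄
    have p₆ : (-(a * τ), 0, a) ∈ O := by simpa using R1 p₅
    have n₆ : (a * τ, 0, -a) ∈ O := by simpa [mul_comm τ a] using R3 p₅
    have n₅ : (-(a * τ), a * τ, -a) ∈ O := by simpa using R1 n₆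
    have n₄ : (0, -(a * τ), a * τ) ∈ O := by simpa [hmul] using R2 n₅
    have n₃ : (0, a, -(a * τ)) ∈ O := by simpa [hmul] using R3 n₄
    have n₂ : (a, -a, 0) ∈ O := by simpa [mul_comm τ a] using R2 n₃
    have n₁ : (-a, 0, 0) ∈ O := by simpa using R1 n₂
    rintro q (rfl | rfl | rfl | rfl | rfl | rfl | rfl | rfl | rfl | rfl | rfl | rfl) <;>
      assumption
  · have hne : a * τ ≠ a := by
      intro h
      rw [h, mul_comm τ a, h] at hmul
      linarith
    generalize a * τ = b at *
    have ha₀ : a ≠ -a := fun h => by linarith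
    have hb₀ : b ≠ -b := fun h => by linarith
    simp [ha.ne, ha.ne', haτ.ne, haτ.ne', hne, hne.symm, ha₀, ha₀.symm, hb₀, hb₀.symm]
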